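/- Assume the Generalized Continuum Hypothesis. Let X be an infinite zero-dimensional Tychonoff space. Then C_p(X) has a point-separating discrete subspace if and only if s(X^n) ≥ iw(X) for some natural number n ≥ 1. -/

import Mathlib

open Cardinal Set

universe u

/-- `C_p(X)`: continuous real-valued functions with the topology of pointwise
convergence (subspace of the product `X → ℝ`). -/
def Cp (X : Type u) [TopologicalSpace X] : Type u := {f : X → ℝ // Continuous f}

instance (X : Type u) [TopologicalSpace X] : TopologicalSpace (Cp X) :=
  inferInstanceAs (TopologicalSpace {f : X → ℝ // Continuous f})

/-- The spread of a space: the supremum of cardinalities of its discrete subspaces. -/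
noncomputable def spread (Y : Type u) [TopologicalSpace Y] : Cardinal.{u} :=
  ⨆ D : {D : Set Y // DiscreteTopology ↥D}, #↥D.1

/-- The weight of a space: the least cardinality of a topological basis. -/
noncomputable def weight (X : Type u) [TopologicalSpace X] : Cardinal.{u} :=
  ⨅ B : {B : Set (Set X) // TopologicalSpace.IsTopologicalBasis B}, #↥B.1

/-- The i-weight of a space: the least weight of a coarser Tychonoff topology on the
same underlying set. -/
noncomputable def iweight (X : Type u) [t : TopologicalSpace X] : Cardinal.{u} :=
  ⨅ t' : {t' : TopologicalSpace X // t ≤ t' ∧ @T35Space X t'}, @weight X t'.1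

/-- The σ-product of `X^ω` with basepoint `b`: all points of the countable power
differing from `b` in at most finitely many coordinates. -/
def sigmaProd (X : Type u) [TopologicalSpace X] (b : ℕ → X) : Set (ℕ → X) :=
  {y | {n | y n ≠ b n}.Finite}

/-- A set of pairs of continuous functions separates points of `X`. -/
def PointSep2 {X : Type u} [TopologicalSpace X] (F : Set (Cp X × Cp X)) : Prop :=
  ∀ x y : X, x ≠ y → ∃ p ∈ F, p.1.1 x ≠ p.1.1 y ∨ p.2.1 x ≠ p.2.1 y

/-- A set of continuous functions separates points of `X`. -/
def PointSep1 {X : Type u} [TopologicalSpace X] (F : Set (Cp X)) : Prop :=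
  ∀ x y : X, x ≠ y → ∃ f ∈ F, f.1 x ≠ f.1 y

/-- A point-separating set in `C_p^m(X)`. -/
def PointSepM {X : Type u} [TopologicalSpace X] {m : ℕ} (F : Set (Fin m → Cp X)) : Prop :=
  ∀ x y : X, x ≠ y → ∃ f ∈ F, ∃ i, (f i).1 x ≠ (f i).1 y

/-- A functionally closed set (zero-set). -/
def FunctionallyClosed {X : Type u} [TopologicalSpace X] (A : Set X) : Prop :=
  ∃ g : X → ℝ, Continuous g ∧ A = g ⁻¹' {0}

/-- Zero-dimensionality in the sense of covering dimension (`dim X = 0`): any two disjoint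
functionally closed sets are separated by a clopen set. -/
def ZeroDimensional (X : Type u) [TopologicalSpace X] : Prop :=
  ∀ A B : Set X, FunctionallyClosed A → FunctionallyClosed B → Disjoint A B →
    ∃ U : Set X, IsClopen U ∧ A ⊆ U ∧ Disjoint U B


open Topology

/-- Šapirovskiĭ-type lemma. -/
theorem exists_discrete_cover {Y : Type u} [TopologicalSpace Y] (A : Set Y) (W : Y → Set Y)
    (hW : ∀ x ∈ A, IsOpen (W x) ∧ x ∈ W x) :
    ∃ D : Set Y, D ⊆ A ∧ DiscreteTopology ↥D ∧ A ⊆ closure D ∪ ⋃ d ∈ D, W d := by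
  have wf : WellFounded (WellOrderingRel : Y → Y → Prop) := WellOrderingRel.isWellOrder.wf
  let P : Y → Prop := wf.fix (fun x ih => x ∈ A ∧
    x ∉ closure {d | ∃ h : WellOrderingRel d x, ih d h} ∧
    ∀ d, ∀ h : WellOrderingRel d x, ih d h → x ∉ W d)
  have hP : ∀ x, P x ↔ (x ∈ A ∧ x ∉ closure {d | WellOrderingRel d x ∧ P d} ∧
      ∀ d, WellOrderingRel d x → P d → x ∉ W d) := by
    intro x
    have := wf.fix_eq (C := fun _ => Prop) (fun x ih => x ∈ A ∧
      x ∉ closure {d | ∃ h : WellOrderingRel d x, ih d h} ∧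
      ∀ d, ∀ h : WellOrderingRel d x, ih d h → x ∉ W d) x
    have h2 := iff_of_eq this
    simpa only [exists_prop] using h2
  refine ⟨{x | P x}, fun x hx => ((hP x).1 hx).1, ?_, ?_⟩
  · rw [discreteTopology_subtype_iff']
    intro x hx
    have h := (hP x).1 hx
    refine ⟨W x ∩ (closure {d | WellOrderingRel d x ∧ P d})ᶜ,
      (hW x h.1).1.inter isClosed_closure.isOpen_compl, ?_⟩
    ext y
    constructor
    · rintro ⟨⟨hy1, hy2⟩, hy3⟩
      rcases trichotomous_of (WellOrderingRel : Y → Y → Prop) x y with h1 | h1 | h1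
      · exact absurd hy1 (((hP y).1 hy3).2.2 x h1 hx)
      · exact h1.symm
      · exact absurd (subset_closure (show y ∈ {d | WellOrderingRel d x ∧ P d} from ⟨h1, hy3⟩)) hy2
    · rintro rfl
      exact ⟨⟨(hW _ h.1).2, h.2.1⟩, hx⟩
  · intro x hx
    by_cases hPx : P x
    · exact Or.inl (subset_closure hPx)
    · rw [hP] at hPx
      by_contra hcon
      apply hPx
      refine ⟨hx, fun h => hcon (Or.inl (closure_mono (fun d hd => hd.2) h)), ?_⟩
      intro d _ hd hxd
      exact hcon (Or.inr (mem_biUnion (show d ∈ {x | P x} from hd) hxd))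

theorem mk_closure_le_two_pow {X : Type u} [TopologicalSpace X] [T3Space X] (E : Set X) :
    #(closure E : Set X) ≤ 2 ^ (2 ^ #E : Cardinal) := by
  rw [← Cardinal.mk_set, ← Cardinal.mk_set]
  refine Cardinal.mk_le_of_injective
    (f := fun x : closure E => {A : Set E | x.1 ∈ closure (Subtype.val '' A)}) ?_
  rintro ⟨x, hx⟩ ⟨y, hy⟩ hxy
  by_contra hne
  have hne' : x ≠ y := fun h => hne (Subtype.ext h)
  obtain ⟨U, V, hU, hV, hxU, hyV, hd⟩ := t2_separation hne'
  have h1 : (Subtype.val ⁻¹' U : Set E) ∈ {A : Set E | x ∈ closure (Subtype.val '' A)} := by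
    change x ∈ closure _
    rw [Subtype.image_preimage_coe, mem_closure_iff]
    intro O hO hxO
    obtain ⟨z, hz, hzE⟩ := mem_closure_iff.1 hx (O ∩ U) (hO.inter hU) ⟨hxO, hxU⟩
    exact ⟨z, hz.1, hzE, hz.2⟩
  have h2 : (Subtype.val ⁻¹' U : Set E) ∈ {A : Set E | y ∈ closure (Subtype.val '' A)} := by
    have := hxy
    simp only at this
    rw [← this]; exact h1
  change y ∈ closure _ at h2
  rw [Subtype.image_preimage_coe, mem_closure_iff] at h2
  obtain ⟨z, hz, hzE⟩ := h2 V hV hyV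
  exact Set.disjoint_left.1 hd hzE.2 hz

theorem iweight_le_of_sep {X : Type u} [t : TopologicalSpace X] {ι : Type u} (f : ι → X → ℝ)
    (hf : ∀ i, Continuous (f i)) (hs : ∀ x y, x ≠ y → ∃ i, f i x ≠ f i y) :
    iweight X ≤ max ℵ₀ #ι := by
  let Φ : X → (ι → ℝ) := fun x i => f i x
  have hΦ : Function.Injective Φ := by
    intro x y h
    by_contra hne
    obtain ⟨i, hi⟩ := hs x y hne
    exact hi (congrFun h i)
  have hle0 := continuous_iff_le_induced.1 (continuous_pi hf : Continuous Φ)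
  let t' : TopologicalSpace X := TopologicalSpace.induced Φ inferInstance
  have hle : t ≤ t' := hle0
  have ht35 : @T35Space X t' :=
    @Topology.IsEmbedding.t35Space X t' _ _ _ Φ (@Topology.IsEmbedding.mk _ _ t' _ _ ⟨rfl⟩ hΦ)
  have h1 : @iweight X t ≤ @weight X t' :=
    ciInf_le' (fun t' : {t' : TopologicalSpace X // t ≤ t' ∧ @T35Space X t'} => @weight X t'.1)
      ⟨t', hle, ht35⟩
  refine h1.trans ?_
  let S : ι × ℚ × ℚ → Set X := fun p => f p.1 ⁻¹' Ioo (p.2.1 : ℝ) p.2.2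
  have hgen : t' = TopologicalSpace.generateFrom (range S) := by
    apply le_antisymm
    · apply le_generateFrom
      rintro _ ⟨p, rfl⟩
      have : @Continuous X ℝ t' _ (f p.1) :=
        (continuous_apply p.1).comp (continuous_induced_dom (f := Φ))
      exact @IsOpen.preimage X ℝ t' _ _ this _ isOpen_Ioo
    · apply continuous_iff_le_induced.1
      refine @continuous_pi X ι _ (TopologicalSpace.generateFrom (range S)) _ _ fun i => ?_
      refine (@TopologicalSpace.IsTopologicalBasis.continuous_iff X ℝ
        (TopologicalSpace.generateFrom (range S)) _ _ Real.isTopologicalBasis_Ioo_rat _).2 ?_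
      intro s hs
      simp only [mem_iUnion, mem_singleton_iff] at hs
      obtain ⟨a, b, _, rfl⟩ := hs
      exact TopologicalSpace.isOpen_generateFrom_of_mem ⟨(i, a, b), rfl⟩
  have hb := @TopologicalSpace.isTopologicalBasis_of_subbasis X t' _ hgen
  have h2 : @weight X t' ≤ _ := ciInf_le'
    (fun B : {B : Set (Set X) // @TopologicalSpace.IsTopologicalBasis X t' B} => #↥B.1) ⟨_, hb⟩
  refine h2.trans ?_
  have h3 : ((fun f => ⋂₀ f) '' { f : Set (Set X) | f.Finite ∧ f ⊆ range S }) ⊆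
      range (fun s : Finset (ι × ℚ × ℚ) => ⋂ p ∈ s, S p) := by
    rintro _ ⟨g, ⟨hg, hgs⟩, rfl⟩
    classical
    obtain ⟨s, hs⟩ := Set.subset_range_iff_exists_image_eq.1 hgs
    obtain ⟨s', hs', hinj⟩ := Set.exists_subset_bijOn s S
    rw [hs] at hinj
    have hfin : s'.Finite := hinj.finite_iff_finite.2 hg
    refine ⟨hfin.toFinset, ?_⟩
    simp only [Finite.mem_toFinset]
    rw [← hinj.image_eq, sInter_image]
  refine (Cardinal.mk_le_mk_of_subset h3).trans (Cardinal.mk_range_le.trans ?_)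
  have h5 : #(ι × ℚ × ℚ) ≤ max ℵ₀ #ι := by
    have := Cardinal.mul_le_max #ι ℵ₀
    simp only [le_sup_iff] at this
    simp
    tauto
  cases isEmpty_or_nonempty ι with
  | inl h =>
    exact le_max_of_le_left (Cardinal.mk_le_aleph0 (α := Finset (ι × ℚ × ℚ)))
  | inr h => rw [Cardinal.mk_finset_of_infinite]; exact h5

theorem exists_sep01 {X : Type u} [TopologicalSpace X] [T35Space X] {x y : X} (h : x ≠ y) :
    ∃ f : X → ℝ, Continuous f ∧ f x = 0 ∧ f y = 1 := by
  obtain ⟨f, hf, h0, h1⟩ := CompletelyRegularSpace.completely_regular x {y} isClosed_singleton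
    (by simpa using h)
  refine ⟨fun z => (f z : ℝ), continuous_subtype_val.comp hf, by simp [h0], ?_⟩
  have := h1 (mem_singleton y)
  simp [this]

theorem exists_discrete_iweight_le {X : Type u} [TopologicalSpace X] [T35Space X] :
    ∃ D : Set (Fin 2 → X), DiscreteTopology ↥D ∧
      iweight X ≤ 2 ^ (2 ^ (max ℵ₀ #D) : Cardinal) := by
  have hsep : ∀ p : Fin 2 → X, ∃ f : X → ℝ, Continuous f ∧ (p 0 ≠ p 1 → f (p 0) = 0 ∧ f (p 1) = 1) := by
    intro p
    by_cases h : p 0 = p 1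
    · exact ⟨fun _ => 0, continuous_const, fun h' => absurd h h'⟩
    · obtain ⟨f, hf, h0, h1⟩ := exists_sep01 h
      exact ⟨f, hf, fun _ => ⟨h0, h1⟩⟩
  choose f hf hf01 using hsep
  obtain ⟨D, hDA, hD, hcov⟩ := exists_discrete_cover {p : Fin 2 → X | p 0 ≠ p 1}
    (fun p => {q | f p (q 0) < 1/3 ∧ 2/3 < f p (q 1)}) (by
      intro p hp
      constructor
      · exact (isOpen_lt ((hf p).comp (continuous_apply 0)) continuous_const).inter
          (isOpen_lt continuous_const ((hf p).comp (continuous_apply 1)))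
      · have := hf01 p hp
        constructor
        · rw [this.1]; norm_num
        · rw [this.2]; norm_num)
  refine ⟨D, hD, ?_⟩
  let E : Set X := (fun p : Fin 2 → X => p 0) '' D ∪ (fun p : Fin 2 → X => p 1) '' D
  have hE : #E ≤ max ℵ₀ #D := by
    refine (Cardinal.mk_union_le _ _).trans ?_
    refine (add_le_add Cardinal.mk_image_le Cardinal.mk_image_le).trans ?_
    refine (Cardinal.add_le_max _ _).trans ?_
    rw [max_self, max_comm]
  have hcl : ∀ i : Fin 2, ∀ p ∈ closure D, p i ∈ closure E := by
    intro i p hp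
    have h1 : p i ∈ closure ((fun p : Fin 2 → X => p i) '' D) :=
      image_closure_subset_closure_image (continuous_apply i) ⟨p, hp, rfl⟩
    refine closure_mono ?_ h1
    fin_cases i
    · exact subset_union_left
    · exact subset_union_right
  let g : (D ⊕ (closure E × closure E)) → X → ℝ := fun s => match s with
    | Sum.inl d => f d.1
    | Sum.inr p => f ![p.1.1, p.2.1]
  have key := iweight_le_of_sep g (by
      rintro (d | p)
      · exact hf _
      · exact hf _) (by
      intro x y hxy
      rcases hcov (show ![x, y] ∈ {p : Fin 2 → X | p 0 ≠ p 1} by simpa using hxy) with h | h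
      · refine ⟨Sum.inr (⟨x, by simpa using hcl 0 _ h⟩, ⟨y, by simpa using hcl 1 _ h⟩), ?_⟩
        have := hf01 ![x, y] (by simpa using hxy)
        simp only [Matrix.cons_val_zero, Matrix.cons_val_one] at this
        simp only [g]
        rw [this.1, this.2]; norm_num
      · simp only [mem_iUnion] at h
        obtain ⟨d, hd, h⟩ := h
        refine ⟨Sum.inl ⟨d, hd⟩, ?_⟩
        simp only [mem_ofPred_eq, Matrix.cons_val_zero, Matrix.cons_val_one] at h
        simp only [g]
        intro heq
        linarith [h.1, h.2])
  refine key.trans ?_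
  set lam : Cardinal := max ℵ₀ #D with hlam
  have hl0 : ℵ₀ ≤ lam := le_max_left _ _
  have hl1 : lam ≤ 2 ^ (2 ^ lam : Cardinal) := (Cardinal.cantor _).le.trans (Cardinal.cantor _).le
  have hcE : #(closure E : Set X) ≤ 2 ^ (2 ^ lam : Cardinal) :=
    (mk_closure_le_two_pow E).trans
      (Cardinal.power_le_power_left two_ne_zero (Cardinal.power_le_power_left two_ne_zero hE))
  have hbig : ℵ₀ ≤ 2 ^ (2 ^ lam : Cardinal) := hl0.trans hl1
  refine max_le hbig ?_
  rw [Cardinal.mk_sum, Cardinal.mk_prod]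
  simp only [Cardinal.lift_id]
  exact Cardinal.add_le_of_le hbig ((le_max_right _ _).trans hl1)
    ((mul_le_mul' hcE hcE).trans (Cardinal.mul_eq_self hbig).le)

theorem exists_clopen_sep {X : Type u} [t : TopologicalSpace X] [T35Space X]
    (hzd : ZeroDimensional X) :
    ∃ (ι : Type u) (U : ι → Set X), #ι ≤ max ℵ₀ (iweight X) ∧ (∀ i, IsClopen (U i)) ∧
      ∀ x y, x ≠ y → ∃ i, x ∈ U i ∧ y ∉ U i := by
  have : Nonempty {t' : TopologicalSpace X // t ≤ t' ∧ @T35Space X t'} :=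
    ⟨⟨t, le_rfl, inferInstance⟩⟩
  obtain ⟨⟨t', hle, ht35⟩, hw⟩ := ciInf_mem
    (fun t' : {t' : TopologicalSpace X // t ≤ t' ∧ @T35Space X t'} => @weight X t'.1)
  have : Nonempty {B : Set (Set X) // @TopologicalSpace.IsTopologicalBasis X t' B} :=
    ⟨⟨_, @TopologicalSpace.isTopologicalBasis_opens X t'⟩⟩
  obtain ⟨⟨B, hB⟩, hBw⟩ := ciInf_mem
    (fun B : {B : Set (Set X) // @TopologicalSpace.IsTopologicalBasis X t' B} => #↥B.1)
  have hBc : #B = @iweight X t := hBw.trans hw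
  have hch : ∀ p : B × B, ∃ K : Set X, @IsClopen X t K ∧
      ((∃ K' : Set X, @IsClopen X t K' ∧ p.1.1 ⊆ K' ∧ Disjoint K' p.2.1) →
        p.1.1 ⊆ K ∧ Disjoint K p.2.1) := by
    intro p
    by_cases h : ∃ K' : Set X, @IsClopen X t K' ∧ p.1.1 ⊆ K' ∧ Disjoint K' p.2.1
    · obtain ⟨K, hK, h2⟩ := h
      exact ⟨K, hK, fun _ => h2⟩
    · exact ⟨∅, @isClopen_empty X t, fun h' => absurd h' h⟩
  choose U hUc hU using hch
  refine ⟨B × B, U, ?_, hUc, ?_⟩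
  · rw [Cardinal.mk_prod]
    simp only [Cardinal.lift_id]
    rw [hBc]
    refine (Cardinal.mul_le_max _ _).trans ?_
    rw [max_self, max_comm]
  · intro x y hxy
    obtain ⟨f, hf, h0, h1⟩ := @exists_sep01 X t' ht35 x y hxy
    have hft : @Continuous X ℝ t _ f := continuous_le_dom hle hf
    obtain ⟨K, hK, hK1, hK2⟩ := hzd {z | f z ≤ 1/3} {z | 2/3 ≤ f z}
      ⟨fun z => max (f z - 1/3) 0, by fun_prop, by
        ext z; simp⟩
      ⟨fun z => max (2/3 - f z) 0, by fun_prop, by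
        ext z; simp⟩
      (by
        rw [Set.disjoint_left]
        intro z hz hz'
        simp only [mem_ofPred_eq] at hz hz'
        linarith)
    obtain ⟨V1, hV1, hx1, hV1s⟩ := hB.exists_subset_of_mem_open
      (show x ∈ f ⁻¹' Iio (1/3) by simp [h0]) (@IsOpen.preimage X ℝ t' _ f hf _ isOpen_Iio)
    obtain ⟨V2, hV2, hx2, hV2s⟩ := hB.exists_subset_of_mem_open
      (show y ∈ f ⁻¹' Ioi (2/3) by simp [h1]; norm_num)
      (@IsOpen.preimage X ℝ t' _ f hf _ isOpen_Ioi)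
    have := hU (⟨V1, hV1⟩, ⟨V2, hV2⟩) ⟨K, hK,
      fun z hz => hK1 (show f z ≤ 1/3 from le_of_lt (hV1s hz : f z < 1/3)),
      hK2.mono_right (show V2 ⊆ {z | 2/3 ≤ f z} from
        fun z hz => (show 2/3 ≤ f z from le_of_lt (hV2s hz : 2/3 < f z)))⟩
    exact ⟨(⟨V1, hV1⟩, ⟨V2, hV2⟩), this.1 hx1, fun h => Set.disjoint_left.1 this.2 h hx2⟩

theorem exists_clopen_nhd {X : Type u} [TopologicalSpace X] [T35Space X]
    (hzd : ZeroDimensional X) (x : X) (O : Set X) (hO : IsOpen O) (hx : x ∈ O) :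
    ∃ W : Set X, IsClopen W ∧ x ∈ W ∧ W ⊆ O := by
  obtain ⟨f, hf, h0, h1⟩ := CompletelyRegularSpace.completely_regular_isOpen x O hO hx
  have hf' : Continuous fun z => (f z : ℝ) := continuous_subtype_val.comp hf
  obtain ⟨K, hK, hK1, hK2⟩ := hzd {z | (f z : ℝ) = 0} {z | (f z : ℝ) = 1}
      ⟨fun z => f z, hf', by ext z; simp⟩
      ⟨fun z => f z - 1, by fun_prop, by ext z; simp [sub_eq_zero]⟩
      (by
        rw [Set.disjoint_left]
        intro z hz hz'
        simp only [mem_ofPred_eq] at hz hz'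
        linarith)
  refine ⟨K, hK, hK1 (by simp [h0]), fun z hz => ?_⟩
  by_contra hzO
  exact Set.disjoint_left.1 hK2 hz (by simpa using h1 hzO)

theorem exists_extend {X : Type u} [TopologicalSpace X] (S : Finset X) (W : X → Set X)
    (hW : ∀ x, IsClopen (W x)) (hd : (S : Set X).PairwiseDisjoint W) (v : X → ℤ)
    (b : X → ℤ) (hb : Continuous b) :
    ∃ f : X → ℤ, Continuous f ∧ (∀ y ∈ S, ∀ x ∈ W y, f x = v y) ∧
      ∀ x, (∀ y ∈ S, x ∉ W y) → f x = b x := by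
  classical
  induction S using Finset.induction_on with
  | empty => exact ⟨b, hb, by simp, fun _ _ => rfl⟩
  | insert a S ha ih =>
    obtain ⟨f, hf, h1, h2⟩ := ih (hd.subset (by simp))
    refine ⟨(W a).piecewise (fun _ => v a) f, ?_, ?_, ?_⟩
    · refine Continuous.piecewise ?_ continuous_const hf
      intro x hx
      rw [(hW a).frontier_eq] at hx
      exact hx.elim
    · intro y hy x hx
      rcases Finset.mem_insert.1 hy with rfl | hy
      · simp [hx]
      · have hne : y ≠ a := fun h => ha (h ▸ hy)
        have : x ∉ W a := fun h => Set.disjoint_left.1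
          (hd (by simp [hy]) (by simp) hne) hx h
        rw [Set.piecewise_eq_of_notMem _ _ _ this]
        exact h1 y hy x hx
    · intro x hx
      rw [Set.piecewise_eq_of_notMem _ _ _ (hx a (by simp))]
      exact h2 x fun y hy => hx y (by simp [hy])

theorem local_pair {X : Type u} [TopologicalSpace X] [T35Space X]
    (hzd : ZeroDimensional X) {n : ℕ} (d : Fin n → X) (O : Set (Fin n → X)) (hO : IsOpen O)
    (hdO : d ∈ O) (U : Set X) (hU : IsClopen U) (v : X → ℤ) (hv : InjOn v (range d))
    (hpos : ∀ x, 0 < v x) :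
    ∃ f : Bool → X → ℤ, (∀ s, Continuous (f s)) ∧ (∀ s i, f s (d i) = v (d i)) ∧
      (∀ s x, f s x ≤ 0 ∨ ∃ i, f s x = v (d i)) ∧
      (∀ s (y : Fin n → X), (∀ i, f s (y i) = v (d i)) → y ∈ O) ∧
      (∀ x y, x ∈ U → y ∉ U → ∃ s, f s x ≠ f s y) := by
  classical
  obtain ⟨u, hu, huO⟩ := isOpen_pi_iff'.1 hO d hdO
  obtain ⟨T, hT, hTd⟩ := (finite_range d).t2_separation
  have hN : ∀ x : X, ∃ W : Set X, IsClopen W ∧ x ∈ W ∧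
      W ⊆ T x ∩ (⋂ i, ⋂ _ : d i = x, u i) ∩ (if x ∈ U then U else Uᶜ) := by
    intro x
    apply exists_clopen_nhd hzd
    · refine ((hT x).2.inter ?_).inter ?_
      · exact isOpen_iInter_of_finite fun i => isOpen_iInter_of_finite fun _ => (hu i).1
      · split_ifs
        · exact hU.isOpen
        · exact hU.compl.isOpen
    · refine ⟨⟨(hT x).1, ?_⟩, ?_⟩
      · simp only [mem_iInter]
        rintro i rfl
        exact (hu i).2
      · split_ifs with h
        · exact h
        · exact h
  choose W hWc hxW hWs using hN
  set S : Finset X := Finset.univ.image d with hS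
  have hSr : (S : Set X) = range d := by simp [hS]
  have hd : (S : Set X).PairwiseDisjoint W := by
    rw [hSr]
    intro x hx y hy hxy
    exact (hTd hx hy hxy).mono (fun z hz => (hWs x hz).1.1) (fun z hz => (hWs y hz).1.1)
  have hb : Continuous (U.piecewise (fun _ => (-1 : ℤ)) (fun _ => 0)) := by
    refine Continuous.piecewise ?_ continuous_const continuous_const
    intro x hx
    rw [hU.frontier_eq] at hx
    exact hx.elim
  obtain ⟨f, hf, hf1, hf2⟩ := exists_extend S W hWc hd v (fun _ => 0) continuous_const
  obtain ⟨g, hg, hg1, hg2⟩ := exists_extend S W hWc hd v _ hb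
  have hdS : ∀ i, d i ∈ S := fun i => by simp [hS]
  have hF1 : ∀ s : Bool, ∀ y ∈ S, ∀ x ∈ W y, (bif s then f else g) x = v y := by
    rintro (_ | _)
    · exact hg1
    · exact hf1
  have hF2 : ∀ s : Bool, ∀ x, (∀ y ∈ S, x ∉ W y) → (bif s then f else g) x ≤ 0 := by
    rintro (_ | _) x hx
    · change g x ≤ 0
      rw [hg2 x hx]
      by_cases h : x ∈ U <;> simp [h]
    · exact (hf2 x hx).le
  have hcase : ∀ x, (∃ i, x ∈ W (d i)) ∨ (∀ y ∈ S, x ∉ W y) := by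
    intro x
    by_cases h : ∀ y ∈ S, x ∉ W y
    · exact Or.inr h
    · push Not at h
      obtain ⟨y, hy, hx⟩ := h
      obtain ⟨i, rfl⟩ : y ∈ range d := hSr ▸ (Finset.mem_coe.2 hy)
      exact Or.inl ⟨i, hx⟩
  refine ⟨fun s => bif s then f else g, ?_, ?_, ?_, ?_, ?_⟩
  · rintro (_ | _)
    · exact hg
    · exact hf
  · intro s i
    exact hF1 s _ (hdS i) _ (hxW _)
  · intro s x
    rcases hcase x with ⟨i, hi⟩ | h
    · exact Or.inr ⟨i, hF1 s _ (hdS i) _ hi⟩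
    · exact Or.inl (hF2 s x h)
  · intro s y hy
    apply huO
    intro i _
    rcases hcase (y i) with ⟨j, hj⟩ | h
    · have h1 := hF1 s _ (hdS j) _ hj
      have h2 := hy i
      simp only at h2
      rw [h1] at h2
      have h3 : d j = d i := hv (mem_range_self j) (mem_range_self i) h2
      have h4 := (hWs _ hj).1.2
      simp only [mem_iInter] at h4
      exact h4 i h3.symm
    · have h1 := hF2 s _ h
      have h2 := hy i
      simp only at h2
      have := hpos (d i)
      omega
  · intro x y hx hy
    rcases hcase x with ⟨i, hi⟩ | hx'
    · refine ⟨true, ?_⟩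
      change f x ≠ f y
      rw [hf1 _ (hdS i) _ hi]
      rcases hcase y with ⟨j, hj⟩ | hy'
      · rw [hf1 _ (hdS j) _ hj]
        intro h
        have h3 : d i = d j := hv (mem_range_self i) (mem_range_self j) h
        rw [← h3] at hj
        have h1 := (hWs _ hi).2
        have h2 := (hWs _ hj).2
        split_ifs at h1 h2 with h5
        · exact hy h2
        · exact h1 hx
      · rw [hf2 _ hy']
        exact (hpos _).ne'
    · rcases hcase y with ⟨j, hj⟩ | hy'
      · refine ⟨true, ?_⟩
        change f x ≠ f y
        rw [hf1 _ (hdS j) _ hj, hf2 _ hx']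
        exact (hpos _).ne
      · refine ⟨false, ?_⟩
        change g x ≠ g y
        rw [hg2 _ hx', hg2 _ hy']
        simp [hx, hy]

instance instT2Cp (X : Type u) [TopologicalSpace X] : T2Space (Cp X) :=
  inferInstanceAs (T2Space {f : X → ℝ // Continuous f})

theorem continuous_eval_Cp {X : Type u} [TopologicalSpace X] (x : X) :
    Continuous (fun f : Cp X => f.1 x) :=
  (continuous_apply x).comp (continuous_subtype_val (p := fun f : X → ℝ => Continuous f))

theorem exists_sep_discrete {X : Type u} [TopologicalSpace X] [T35Space X]
    (hzd : ZeroDimensional X) {n : ℕ} (D : Set (Fin n → X)) (hD : DiscreteTopology ↥D)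
    (hc : max ℵ₀ (iweight X) ≤ #D) :
    ∃ F : Set (Cp X), DiscreteTopology ↥F ∧ PointSep1 F := by
  obtain ⟨ι, U, hι, hUc, hUs⟩ := exists_clopen_sep hzd
  obtain ⟨e⟩ : Nonempty (ι ↪ D) := Cardinal.le_def _ _ |>.1 (hι.trans hc)
  rw [discreteTopology_subtype_iff'] at hD
  choose! O hO hOD using hD
  obtain ⟨code, hcode⟩ := exists_injective_nat (Set (Fin n))
  let v : ι → X → ℤ := fun a x => (code {j | (e a).1 j = x} : ℤ) + 1
  have hvinj : ∀ a b i z, z ∈ range (e b).1 → v b z = v a ((e a).1 i) → z = (e b).1 i := by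
    rintro a b i _ ⟨k, rfl⟩ h
    have h1 : code {j | (e b).1 j = (e b).1 k} = code {j | (e a).1 j = (e a).1 i} := by
      simp only [v] at h
      omega
    have h2 := hcode h1
    have h3 : i ∈ {j | (e b).1 j = (e b).1 k} := by rw [h2]; rfl
    exact h3.symm
  have hself : ∀ a, (e a).1 ∈ O (e a).1 := fun a => by
    have : (e a).1 ∈ O (e a).1 ∩ D := by rw [hOD _ (e a).2]; rfl
    exact this.1
  have hloc := fun a => local_pair hzd (e a).1 (O (e a).1) (hO _ (e a).2) (hself a) (U a) (hUc a) (v a)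
    (by
      rintro x hx y ⟨i, rfl⟩ h
      exact hvinj a a i x hx h)
    (fun x => by simp only [v]; omega)
  choose f hfc hfd hfv hfO hfs using hloc
  let G : ι × Bool → Cp X := fun p => ⟨fun x => (f p.1 p.2 x : ℝ),
    (continuous_of_discreteTopology (f := fun k : ℤ => (k : ℝ))).comp (hfc p.1 p.2)⟩
  refine ⟨range G, ?_, ?_⟩
  · rw [discreteTopology_subtype_iff']
    rintro _ ⟨⟨a, s⟩, rfl⟩
    let N : Set (Cp X) := ⋂ i : Fin n, (fun φ : Cp X => φ.1 ((e a).1 i)) ⁻¹'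
      Ioo ((v a ((e a).1 i) : ℝ) - 1/2) ((v a ((e a).1 i) : ℝ) + 1/2)
    have hN : IsOpen N := isOpen_iInter_of_finite fun i =>
      isOpen_Ioo.preimage (continuous_eval_Cp _)
    have hNG : ∀ b s', G (b, s') ∈ N → b = a := by
      intro b s' h
      have h1 : ∀ i, f b s' ((e a).1 i) = v a ((e a).1 i) := by
        intro i
        have h2 := mem_iInter.1 h i
        change (f b s' ((e a).1 i) : ℝ) ∈ Ioo _ _ at h2
        have h3 : ((f b s' ((e a).1 i) : ℤ) : ℝ) < ((v a ((e a).1 i) + 1 : ℤ) : ℝ) := by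
          push_cast; linarith [h2.2]
        have h4 : ((v a ((e a).1 i) : ℤ) : ℝ) < ((f b s' ((e a).1 i) + 1 : ℤ) : ℝ) := by
          push_cast; linarith [h2.1]
        have h3' := Int.cast_lt.1 h3
        have h4' := Int.cast_lt.1 h4
        omega
      have h2 : (e a).1 ∈ O (e b).1 := by
        apply hfO b s'
        intro i
        rcases hfv b s' ((e a).1 i) with h3 | ⟨k, hk⟩
        · rw [h1 i] at h3
          simp only [v] at h3
          omega
        · rw [hk]
          rw [hvinj a b i _ (mem_range_self k) (hk.symm.trans (h1 i))]
      have h3 : (e a).1 ∈ O (e b).1 ∩ D := ⟨h2, (e a).2⟩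
      rw [hOD _ (e b).2] at h3
      exact (e.injective (Subtype.ext h3)).symm
    have hfin : (range (fun s' => G (a, s')) \ {G (a, s)}).Finite :=
      (finite_range _).subset sdiff_subset
    refine ⟨N ∩ (range (fun s' => G (a, s')) \ {G (a, s)})ᶜ,
      hN.inter hfin.isClosed.isOpen_compl, ?_⟩
    ext φ
    constructor
    · rintro ⟨⟨h1, h2⟩, ⟨⟨b, s'⟩, rfl⟩⟩
      obtain rfl := hNG b s' h1
      by_contra h3
      exact h2 ⟨⟨s', rfl⟩, h3⟩
    · rintro rfl
      refine ⟨⟨?_, fun h => h.2 rfl⟩, ⟨_, rfl⟩⟩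
      refine mem_iInter.2 fun i => ?_
      change (f a s ((e a).1 i) : ℝ) ∈ Ioo _ _
      rw [hfd]
      constructor <;> linarith
  · intro x y hxy
    obtain ⟨a, hx, hy⟩ := hUs x y hxy
    obtain ⟨s, hs⟩ := hfs a x y hx hy
    refine ⟨G (a, s), ⟨_, rfl⟩, ?_⟩
    simpa [G] using hs

theorem mk_le_of_discrete_Cp {X : Type u} [TopologicalSpace X] [Nonempty X]
    (F : Set (Cp X)) (hF : DiscreteTopology ↥F) (μ : Cardinal.{u}) (hμ : ℵ₀ ≤ μ)
    (h : ∀ (n : ℕ) (D : Set (Fin n → X)), DiscreteTopology ↥D → #D ≤ μ) : #F ≤ μ := by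
  have h1 : ∀ f : F, ∃ (n : ℕ) (x : ℕ → X) (m : ℕ), ∀ g ∈ F,
      (∀ i < n, |g.1 (x i) - f.1.1 (x i)| < 1 / ((m : ℝ) + 1)) → g = f.1 := by
    rintro ⟨f, hf⟩
    rw [discreteTopology_subtype_iff'] at hF
    obtain ⟨U, hU, hUF⟩ := hF f hf
    obtain ⟨V, hV, hVU⟩ := isOpen_induced_iff.1 hU
    have hUV : ∀ g : Cp X, g ∈ U ↔ g.1 ∈ V := by
      intro g
      rw [← hVU]
      rfl
    have hfV : f.1 ∈ V := by
      have : f ∈ U ∩ F := by rw [hUF]; rfl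
      exact (hUV f).1 this.1
    obtain ⟨I, u, hu, hIV⟩ := isOpen_pi_iff.1 hV f.1 hfV
    have hm : ∀ᶠ m : ℕ in Filter.atTop, ∀ a ∈ I, Metric.ball (f.1 a) (1 / ((m : ℝ) + 1)) ⊆ u a := by
      rw [Filter.eventually_all_finset]
      intro a ha
      obtain ⟨ε, hε, hb⟩ := Metric.isOpen_iff.1 (hu a ha).1 _ (hu a ha).2
      filter_upwards [tendsto_one_div_add_atTop_nhds_zero_nat.eventually (gt_mem_nhds hε)] with m hm
      exact (Metric.ball_subset_ball hm.le).trans hb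
    obtain ⟨m, hm⟩ := hm.exists
    obtain ⟨x0⟩ := ‹Nonempty X›
    refine ⟨I.card, fun i => if hi : i < I.card then (I.equivFin.symm ⟨i, hi⟩).1 else x0, m, ?_⟩
    intro g hg hgi
    have : g ∈ U ∩ F := by
      refine ⟨(hUV g).2 (hIV ?_), hg⟩
      intro a ha
      apply hm a ha
      have h2 := hgi (I.equivFin ⟨a, ha⟩).1 (I.equivFin ⟨a, ha⟩).2
      simp only [Fin.is_lt, dite_true, Fin.eta, Equiv.symm_apply_apply] at h2
      rw [Metric.mem_ball, Real.dist_eq]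
      exact h2
    rw [hUF] at this
    exact this
  choose n x m hiso using h1
  let code : F → ℕ × ℕ × List ℤ := fun f =>
    (n f, m f, (List.range (n f)).map fun i => ⌊f.1.1 (x f i) * (3 * ((m f : ℝ) + 1))⌋)
  have h2 := Cardinal.lift_mk_le_lift_mk_mul_of_lift_mk_preimage_le (c := μ) code (by
    rintro ⟨N, M, L⟩
    rw [Cardinal.lift_uzero]
    let p : code ⁻¹' {(N, M, L)} → (Fin N → X) := fun f i => x f.1 i
    have hδ : (0 : ℝ) < 3 * ((M : ℝ) + 1) := by positivity
    have key : ∀ f g : code ⁻¹' {(N, M, L)},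
        (∀ i, |g.1.1.1 (p f i) - g.1.1.1 (p g i)| < 1 / (3 * ((M : ℝ) + 1))) → f = g := by
      rintro ⟨f, hf⟩ ⟨g, hg⟩ hfg
      simp only [mem_preimage, mem_singleton_iff, code, Prod.mk.injEq] at hf hg
      have hL := hf.2.2.trans hg.2.2.symm
      rw [hf.1, hg.1, List.map_inj_left, hf.2.1, hg.2.1] at hL
      have : g.1 = f.1 := by
        apply hiso f g.1 g.2
        intro i hi
        rw [hf.1] at hi
        rw [hf.2.1]
        have h3 := hfg ⟨i, hi⟩
        have h4 := Int.abs_sub_lt_one_of_floor_eq_floor (hL i (List.mem_range.2 hi))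
        simp only [p] at h3
        have h5 : |f.1.1 (x f i) - g.1.1 (x g i)| < 1 / (3 * ((M : ℝ) + 1)) := by
          rw [← sub_mul, abs_mul, abs_of_pos hδ] at h4
          rwa [lt_div_iff₀ hδ]
        have h6 : 1 / ((M : ℝ) + 1) = 3 * (1 / (3 * ((M : ℝ) + 1))) := by
          field_simp
        have h7 : 0 < 1 / (3 * ((M : ℝ) + 1)) := by positivity
        rw [h6]
        rw [abs_lt] at *
        constructor <;> linarith [h3.1, h3.2, h5.1, h5.2]
      exact Subtype.ext (Subtype.ext this.symm)
    have hinj : Function.Injective p := by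
      intro f g hfg
      apply key
      intro i
      rw [hfg, sub_self, abs_zero]
      positivity
    rw [← Cardinal.mk_range_eq p hinj]
    apply h
    rw [discreteTopology_subtype_iff']
    rintro _ ⟨g, rfl⟩
    refine ⟨⋂ i : Fin N, {y | |g.1.1.1 (y i) - g.1.1.1 (p g i)| < 1 / (3 * ((M : ℝ) + 1))}, ?_, ?_⟩
    · refine isOpen_iInter_of_finite fun i => ?_
      have hc := (g.1.1.2.comp (continuous_apply (A := fun _ : Fin N => X) i))
      exact isOpen_lt (hc.sub continuous_const).abs continuous_const
    · ext y
      constructor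
      · rintro ⟨hy, ⟨f, rfl⟩⟩
        rw [key f g (fun i => mem_iInter.1 hy i)]
        rfl
      · rintro rfl
        refine ⟨mem_iInter.2 fun i => ?_, mem_range_self _⟩
        simp only [mem_ofPred_eq, sub_self, abs_zero]
        positivity)
  rw [Cardinal.lift_uzero] at h2
  refine h2.trans ?_
  refine (mul_le_mul_left (Cardinal.lift_le_aleph0.2 Cardinal.mk_le_aleph0) μ).trans ?_
  exact Cardinal.aleph0_mul_eq hμ |>.le

theorem iweight_succ {X : Type u} [TopologicalSpace X] [T35Space X]
    (gch : ∀ κ : Cardinal.{u}, ℵ₀ ≤ κ → 2 ^ κ = Order.succ κ)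
    (h0 : ℵ₀ < iweight X)
    (h : ∀ D : Set (Fin 2 → X), DiscreteTopology ↥D → #D < iweight X) :
    ∃ μ : Cardinal.{u}, ℵ₀ ≤ μ ∧ iweight X = Order.succ μ := by
  obtain ⟨D, hD, hle⟩ := exists_discrete_iweight_le (X := X)
  have hlt : max ℵ₀ #D < iweight X := max_lt h0 (h D hD)
  set lam := max ℵ₀ #D with hlam
  have hl : ℵ₀ ≤ lam := le_max_left _ _
  have hl' : ℵ₀ ≤ Order.succ lam := hl.trans (Order.le_succ _)
  rw [gch lam hl, gch _ hl'] at hle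
  rcases (Order.succ_le_of_lt hlt).eq_or_lt with h1 | h1
  · exact ⟨lam, hl, h1.symm⟩
  · exact ⟨_, hl', le_antisymm hle (Order.succ_le_of_lt h1)⟩

theorem le_spread {Y : Type u} [TopologicalSpace Y] (D : Set Y) (hD : DiscreteTopology ↥D) :
    #D ≤ spread Y :=
  le_ciSup (f := fun D : {D : Set Y // DiscreteTopology ↥D} => #↥D.1)
    Cardinal.bddAbove_of_small ⟨D, hD⟩

theorem exists_infinite_discrete_one (X : Type u) [TopologicalSpace X] [T35Space X] [Infinite X] :
    ∃ D : Set (Fin 1 → X), DiscreteTopology ↥D ∧ ℵ₀ ≤ #D := by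
  have : Infinite (Fin 1 → X) := inferInstance
  obtain ⟨s, hs, hd⟩ := exists_infinite_discreteTopology (Fin 1 → X)
  have := hs.to_subtype
  exact ⟨s, hd, Cardinal.aleph0_le_mk _⟩

/-- (GCH) If `X` is zero-dimensional, then `C_p(X)` has a point-separating discrete
subspace iff `s(X^n) ≥ iw(X)` for some `n ≥ 1`. -/
theorem stmt10 {X : Type u} [TopologicalSpace X] [T35Space X] [Infinite X]
    (gch : ∀ κ : Cardinal.{u}, ℵ₀ ≤ κ → 2 ^ κ = Order.succ κ)
    (hzd : ZeroDimensional X) :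
    (∃ F : Set (Cp X), DiscreteTopology ↥F ∧ PointSep1 F) ↔
      ∃ n : ℕ, 1 ≤ n ∧ iweight X ≤ spread (Fin n → X) := by
  obtain ⟨D1, hD1, hD1c⟩ := exists_infinite_discrete_one X
  constructor
  · rintro ⟨F, hF, hsep⟩
    by_contra hcon
    push Not at hcon
    have h0 : ℵ₀ < iweight X := (hD1c.trans (le_spread D1 hD1)).trans_lt (hcon 1 le_rfl)
    obtain ⟨μ, hμ, hsucc⟩ := iweight_succ gch h0 fun D hD =>
      (le_spread D hD).trans_lt (hcon 2 (by norm_num))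
    have hFμ : #F ≤ μ := by
      refine mk_le_of_discrete_Cp F hF μ hμ ?_
      intro n D hD
      rcases Nat.eq_zero_or_pos n with rfl | hn
      · exact Cardinal.mk_le_aleph0.trans hμ
      · apply Order.lt_succ_iff.1
        rw [← hsucc]
        exact (le_spread D hD).trans_lt (hcon n hn)
    have h2 : iweight X ≤ max ℵ₀ #F := iweight_le_of_sep (fun f : F => f.1.1) (fun f => f.1.2)
      fun x y hxy => by
        obtain ⟨f, hf, hne⟩ := hsep x y hxy
        exact ⟨⟨f, hf⟩, hne⟩
    have h3 := h2.trans (max_le hμ hFμ)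
    rw [hsucc] at h3
    exact absurd h3 (not_le.2 (Order.lt_succ μ))
  · rintro ⟨n, hn, hle⟩
    by_cases h0 : iweight X ≤ ℵ₀
    · exact exists_sep_discrete hzd D1 hD1 (by rwa [max_eq_left h0])
    push Not at h0
    by_cases h2 : ∃ D : Set (Fin 2 → X), DiscreteTopology ↥D ∧ iweight X ≤ #D
    · obtain ⟨D, hD, h⟩ := h2
      exact exists_sep_discrete hzd D hD (by rwa [max_eq_right h0.le])
    push Not at h2
    obtain ⟨μ, hμ, hsucc⟩ := iweight_succ gch h0 h2
    have hlt : μ < spread (Fin n → X) :=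
      lt_of_lt_of_le (by rw [hsucc]; exact Order.lt_succ μ) hle
    obtain ⟨⟨D, hD⟩, hDl⟩ := exists_lt_of_lt_ciSup' hlt
    refine exists_sep_discrete hzd D hD ?_
    rw [max_eq_right h0.le, hsucc]
    exact Order.succ_le_of_lt hDl
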